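/- arXiv:q-alg/9612002 — 7 statements merged into one kernel-verified Lean document; each statement's English description precedes it below -/
import Mathlib

section
/- For all σ, τ ∈ S_n, every ζ ∈ kˣ, and every ζ-family (g_1,…,g_n), one has ρ(στ,(g_1,…,g_n)) = ρ(τ,(g_{σ(1)},…,g_{σ(n)})) · ρ(σ,(g_1,…,g_n)). -/
open Finset

/-- The set of inversions of a permutation `σ` of `Fin n`: pairs `(i,j)` with `i < j`
and `σ i > σ j`. -/
def inversions {n : ℕ} (σ : Equiv.Perm (Fin n)) : Finset (Fin n × Fin n) :=
  Finset.univ.filter fun p => p.1 < p.2 ∧ σ p.2 < σ p.1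

/-- A bicharacter of an (additive) abelian group `G` with values in the units of `k`:
a map multiplicative in each variable. -/
def IsBicharacter {k G : Type*} [CommRing k] [AddCommGroup G] (χ : G → G → kˣ) : Prop :=
  (∀ g g' h : G, χ (g + g') h = χ g h * χ g' h) ∧
    ∀ g h h' : G, χ g (h + h') = χ g h * χ g h'

/-- `(g 1, …, g n)` is a `ζ`-family: `χ(gᵢ,gⱼ)·χ(gⱼ,gᵢ) = ζ²` for all `i ≠ j`. -/
def IsZetaFamily {k G : Type*} [CommRing k] (χ : G → G → kˣ) (ζ : kˣ) {n : ℕ}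
    (g : Fin n → G) : Prop :=
  ∀ i j : Fin n, i ≠ j → χ (g i) (g j) * χ (g j) (g i) = ζ ^ 2

/-- `ρ(σ,(g 1,…,g n)) = ∏ ζ⁻¹ χ(g_{σ(j)}, g_{σ(i)})`, product over inversions of `σ`. -/
def rho {k G : Type*} [CommRing k] (χ : G → G → kˣ) (ζ : kˣ) {n : ℕ}
    (σ : Equiv.Perm (Fin n)) (g : Fin n → G) : kˣ :=
  ∏ p ∈ inversions σ, ζ⁻¹ * χ (g (σ p.2)) (g (σ p.1))

/-- The `n`-ary bracket `[x 1, …, x n] = Σ_σ ρ(σ,(g i)) x_{σ(1)} ⋯ x_{σ(n)}`. -/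
def bracket {k G A : Type*} [CommRing k] [Ring A] [Algebra k A] (χ : G → G → kˣ)
    (ζ : kˣ) {n : ℕ} (g : Fin n → G) (x : Fin n → A) : A :=
  ∑ σ : Equiv.Perm (Fin n),
    ((rho χ ζ σ g : kˣ) : k) • (List.ofFn fun i => x (σ i)).prod

/-- `rho` as a product over all ordered pairs after relabelling
the indices by `τ`. -/
lemma rho_eq_prod_relabel {k G : Type*} [CommRing k] (χ : G → G → kˣ) (ζ : kˣ) {n : ℕ}
    (σ τ : Equiv.Perm (Fin n)) (g : Fin n → G) :
    rho χ ζ σ g = ∏ p : Fin n × Fin n,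
      if τ p.1 < τ p.2 ∧ σ (τ p.2) < σ (τ p.1) then
        ζ⁻¹ * χ (g (σ (τ p.2))) (g (σ (τ p.1))) else 1 := by
  rw [rho, inversions, Finset.prod_filter]
  exact (Equiv.prod_comp (τ.prodCongr τ) _).symm

/-- Lemma (cocycle property of ρ): for all `σ τ ∈ S_n` and every `ζ`-family `(g_1,…,g_n)`,
`ρ(στ,(g_1,…,g_n)) = ρ(τ,(g_{σ(1)},…,g_{σ(n)})) · ρ(σ,(g_1,…,g_n))`. -/
theorem rho_mul {k G : Type*} [CommRing k] [IsDomain k] [AddCommGroup G]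
    (χ : G → G → kˣ) (hχ : IsBicharacter χ) (ζ : kˣ) {n : ℕ}
    (g : Fin n → G) (hg : IsZetaFamily χ ζ g) (σ τ : Equiv.Perm (Fin n)) :
    rho χ ζ (σ * τ) g = rho χ ζ τ (fun i => g (σ i)) * rho χ ζ σ g := by
  rw [rho_eq_prod_relabel χ ζ (σ * τ) 1, rho_eq_prod_relabel χ ζ τ 1,
    rho_eq_prod_relabel χ ζ σ τ, ← Finset.prod_mul_distrib, eq_comm, ← div_eq_one,
    ← Finset.prod_div_distrib]
  refine Finset.prod_involution (fun p _ => p.swap) ?_ ?_ (fun _ _ => mem_univ _)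
    (fun _ _ => Prod.swap_swap _)
  · rintro ⟨i, j⟩ -
    rcases eq_or_ne i j with rfl | hij
    · simp
    have hcancel : ζ⁻¹ * χ (g (σ (τ j))) (g (σ (τ i))) *
        (ζ⁻¹ * χ (g (σ (τ i))) (g (σ (τ j)))) = 1 := by
      rw [mul_mul_mul_comm, hg _ _ (by simpa using hij.symm)]
      group
    have hτ : τ i ≠ τ j := by simpa using hij
    have hσ : σ (τ i) ≠ σ (τ j) := by simpa using hij
    rcases hij.lt_or_gt with h₁ | h₁ <;> rcases hτ.lt_or_gt with h₂ | h₂ <;>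
      rcases hσ.lt_or_gt with h₃ | h₃ <;>
      simp [h₁, h₂, h₃, h₁.not_gt, h₂.not_gt, h₃.not_gt, hcancel]
  · rintro ⟨i, j⟩ - h hswap
    obtain rfl : j = i := congrArg Prod.fst hswap
    simp at h
end

section
/- (First Jacobi identity) Let ζ ∈ k be a primitive n-th root of unity, let (g_1,…,g_{n+1}) be a ζ-family, and let x_i ∈ A_{g_i}. For 1 ≤ i ≤ n+1 let c_i ∈ S_{n+1} be the cycle with c_i(1) = i, c_i(j) = j−1 for 2 ≤ j ≤ i, and c_i(j) = j for j > i. Then Σ_{i=1}^{n+1} ρ(c_i,(g_1,…,g_{n+1})) · ( x_i·[x_1,…,x̂_i,…,x_{n+1}] − (∏_{j≠i} χ(g_i,g_j)) · [x_1,…,x̂_i,…,x_{n+1}]·x_i ) = 0, where [x_1,…,x̂_i,…,x_{n+1}] is the n-ary bracket of the ζ-family obtained by omitting the i-th entry. -/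
open Finset

/-- The permutation of `Fin (n + 1)` sending `p` to `i` and acting as `τ` on the remaining
entries, both complements being identified with `Fin n` in increasing order. -/
def insertPerm {n : ℕ} (p i : Fin (n + 1)) (τ : Equiv.Perm (Fin n)) :
    Equiv.Perm (Fin (n + 1)) :=
  (finSuccEquiv' p).trans ((Equiv.optionCongr τ).trans (finSuccEquiv' i).symm)

lemma insertPerm_apply_self {n : ℕ} (p i : Fin (n + 1)) (τ : Equiv.Perm (Fin n)) :
    insertPerm p i τ p = i := by
  simp [insertPerm]

lemma insertPerm_apply_succAbove {n : ℕ} (p i : Fin (n + 1)) (τ : Equiv.Perm (Fin n))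
    (j : Fin n) : insertPerm p i τ (p.succAbove j) = i.succAbove (τ j) := by
  simp [insertPerm]

lemma insertPerm_bijective {n : ℕ} (p : Fin (n + 1)) :
    Function.Bijective fun q : Fin (n + 1) × Equiv.Perm (Fin n) => insertPerm p q.1 q.2 := by
  rw [Fintype.bijective_iff_injective_and_card]
  refine ⟨?_, by simp [Fintype.card_perm, Nat.factorial_succ]⟩
  rintro ⟨i, τ⟩ ⟨i', τ'⟩ h
  have h' : insertPerm p i τ = insertPerm p i' τ' := h
  have hi : i = i' := by
    simpa [insertPerm_apply_self] using congrArg (fun σ : Equiv.Perm _ => σ p) h'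
  subst hi
  have hτ : τ = τ' := by
    ext1 j
    simpa [insertPerm_apply_succAbove] using
      congrArg (fun σ : Equiv.Perm _ => σ (p.succAbove j)) h'
  rw [hτ]

lemma cycleRange_inv_eq_insertPerm {n : ℕ} (i : Fin (n + 1)) :
    (Fin.cycleRange i)⁻¹ = insertPerm 0 i 1 := by
  ext1 j
  refine Fin.cases ?_ (fun j => ?_) j
  · rw [insertPerm_apply_self]
    exact Fin.cycleRange_symm_zero i
  · rw [← Fin.succAbove_zero_apply, insertPerm_apply_succAbove, Fin.succAbove_zero_apply]
    exact Fin.cycleRange_symm_succ i j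

lemma rho_eq_prod_ite {k G : Type*} [CommRing k] (χ : G → G → kˣ) (ζ : kˣ) {n : ℕ}
    (σ : Equiv.Perm (Fin n)) (g : Fin n → G) :
    rho χ ζ σ g = ∏ a, ∏ b,
      if a < b ∧ σ b < σ a then ζ⁻¹ * χ (g (σ b)) (g (σ a)) else 1 := by
  rw [rho, inversions, Finset.prod_filter, ← Finset.univ_product_univ, Finset.prod_product]

lemma rho_insertPerm {k G : Type*} [CommRing k] (χ : G → G → kˣ) (ζ : kˣ) {n : ℕ}
    (p i : Fin (n + 1)) (τ : Equiv.Perm (Fin n)) (g : Fin (n + 1) → G) :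
    rho χ ζ (insertPerm p i τ) g =
      (∏ j, if p < p.succAbove j ∧ i.succAbove (τ j) < i then
        ζ⁻¹ * χ (g (i.succAbove (τ j))) (g i) else 1) *
      ((∏ j, if p.succAbove j < p ∧ i < i.succAbove (τ j) then
        ζ⁻¹ * χ (g i) (g (i.succAbove (τ j))) else 1) *
      rho χ ζ τ fun j => g (i.succAbove j)) := by
  rw [rho_eq_prod_ite, rho_eq_prod_ite, Fin.prod_univ_succAbove _ p,
    Fin.prod_univ_succAbove _ p]
  simp only [Fin.prod_univ_succAbove _ p, insertPerm_apply_self, insertPerm_apply_succAbove,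
    lt_irrefl, false_and, if_false, one_mul, Finset.prod_mul_distrib,
    Fin.succAbove_lt_succAbove_iff]

lemma rho_insertPerm_zero {k G : Type*} [CommRing k] (χ : G → G → kˣ) (ζ : kˣ) {n : ℕ}
    (i : Fin (n + 1)) (τ : Equiv.Perm (Fin n)) (g : Fin (n + 1) → G) :
    rho χ ζ (insertPerm 0 i τ) g =
      (∏ j, if i.succAbove j < i then ζ⁻¹ * χ (g (i.succAbove j)) (g i) else 1) *
      rho χ ζ τ fun j => g (i.succAbove j) := by
  rw [rho_insertPerm, ← Equiv.prod_comp τ fun j =>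
    if i.succAbove j < i then ζ⁻¹ * χ (g (i.succAbove j)) (g i) else 1]
  simp

lemma rho_insertPerm_last {k G : Type*} [CommRing k] (χ : G → G → kˣ) (ζ : kˣ) {n : ℕ}
    (i : Fin (n + 1)) (τ : Equiv.Perm (Fin n)) (g : Fin (n + 1) → G) :
    rho χ ζ (insertPerm (Fin.last n) i τ) g =
      (∏ j, if i < i.succAbove j then ζ⁻¹ * χ (g i) (g (i.succAbove j)) else 1) *
      rho χ ζ τ fun j => g (i.succAbove j) := by
  rw [rho_insertPerm, ← Equiv.prod_comp τ fun j =>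
    if i < i.succAbove j then ζ⁻¹ * χ (g i) (g (i.succAbove j)) else 1]
  simp [Fin.castSucc_lt_last, (Fin.castSucc_lt_last _).not_gt]

lemma rho_one {k G : Type*} [CommRing k] (χ : G → G → kˣ) (ζ : kˣ) {n : ℕ}
    (g : Fin n → G) : rho χ ζ 1 g = 1 := by
  rw [rho_eq_prod_ite]
  refine Finset.prod_eq_one fun a _ => Finset.prod_eq_one fun b _ => if_neg ?_
  exact fun h => lt_asymm h.1 h.2

lemma rho_cycleRange_inv_mul {k G : Type*} [CommRing k] (χ : G → G → kˣ) (ζ : kˣ) {n : ℕ}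
    (i : Fin (n + 1)) (τ : Equiv.Perm (Fin n)) (g : Fin (n + 1) → G) :
    rho χ ζ (Fin.cycleRange i)⁻¹ g * rho χ ζ τ (fun j => g (i.succAbove j)) =
      rho χ ζ (insertPerm 0 i τ) g := by
  rw [cycleRange_inv_eq_insertPerm, rho_insertPerm_zero, rho_insertPerm_zero, rho_one, mul_one]

lemma rho_cycleRange_inv_mul_prod {k G : Type*} [CommRing k] {χ : G → G → kˣ} {ζ : kˣ} {n : ℕ}
    (hζn : ζ ^ n = 1) {g : Fin (n + 1) → G} (hg : IsZetaFamily χ ζ g)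
    (i : Fin (n + 1)) (τ : Equiv.Perm (Fin n)) :
    rho χ ζ (Fin.cycleRange i)⁻¹ g * (∏ j ∈ Finset.univ.erase i, χ (g i) (g j)) *
        rho χ ζ τ (fun j => g (i.succAbove j)) =
      rho χ ζ (insertPerm (Fin.last n) i τ) g := by
  have herase : ∏ j ∈ Finset.univ.erase i, χ (g i) (g j) =
      ∏ j, χ (g i) (g (i.succAbove j)) := by
    have h := Finset.mul_prod_erase Finset.univ (fun j => χ (g i) (g j)) (Finset.mem_univ i)
    rw [Fin.prod_univ_succAbove _ i] at h
    exact mul_left_cancel h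
  rw [cycleRange_inv_eq_insertPerm, rho_insertPerm_zero, rho_insertPerm_last, rho_one, mul_one,
    herase, ← Finset.prod_mul_distrib]
  congr 1
  have hζ : ∏ _j : Fin n, ζ = 1 := by
    rw [Finset.prod_const, Finset.card_univ, Fintype.card_fin, hζn]
  have hmul (f : Fin n → kˣ) : ∏ j, f j = ∏ j, ζ * f j := by
    rw [Finset.prod_mul_distrib, hζ, one_mul]
  rw [hmul fun j => if i < i.succAbove j then _ else _]
  refine Finset.prod_congr rfl fun j _ => ?_
  rcases lt_or_gt_of_ne (Fin.succAbove_ne i j) with h | h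
  · rw [if_pos h, if_neg h.not_gt, mul_assoc, hg _ _ (Fin.succAbove_ne i j), pow_two,
      inv_mul_cancel_left, mul_one]
  · rw [if_neg h.not_gt, if_pos h, one_mul, mul_inv_cancel_left]

lemma bracket_eq_sum_insertPerm {k G A : Type*} [CommRing k] [Ring A] [Algebra k A]
    (χ : G → G → kˣ) (ζ : kˣ) {n : ℕ} (g : Fin (n + 1) → G) (x : Fin (n + 1) → A)
    (p : Fin (n + 1)) :
    bracket χ ζ g x = ∑ i, ∑ τ : Equiv.Perm (Fin n),
      ((rho χ ζ (insertPerm p i τ) g : kˣ) : k) •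
        (List.ofFn fun j => x (insertPerm p i τ j)).prod := by
  rw [bracket, ← (insertPerm_bijective p).sum_comp, ← Finset.univ_product_univ,
    Finset.sum_product]

lemma prod_ofFn_insertPerm_zero {A : Type*} [Monoid A] {n : ℕ} (x : Fin (n + 1) → A)
    (i : Fin (n + 1)) (τ : Equiv.Perm (Fin n)) :
    (List.ofFn fun j => x (insertPerm 0 i τ j)).prod =
      x i * (List.ofFn fun j => x (i.succAbove (τ j))).prod := by
  rw [List.ofFn_succ, List.prod_cons, insertPerm_apply_self]
  simp only [← Fin.succAbove_zero_apply, insertPerm_apply_succAbove]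

lemma prod_ofFn_insertPerm_last {A : Type*} [Monoid A] {n : ℕ} (x : Fin (n + 1) → A)
    (i : Fin (n + 1)) (τ : Equiv.Perm (Fin n)) :
    (List.ofFn fun j => x (insertPerm (Fin.last n) i τ j)).prod =
      (List.ofFn fun j => x (i.succAbove (τ j))).prod * x i := by
  rw [List.ofFn_succ', List.concat_eq_append, List.prod_append, List.prod_singleton,
    insertPerm_apply_self]
  simp only [← Fin.succAbove_last_apply, insertPerm_apply_succAbove]

/-- (First Jacobi identity) For `ζ` a primitive `n`-th root of unity, a `ζ`-family
`(g_1,…,g_{n+1})` and `x_i ∈ A_{g_i}`, with `c_i` the cycle `(i … 1)`,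
`Σ_i ρ(c_i,(g_•)) (x_i·[x_1,…,x̂_i,…,x_{n+1}] − (∏_{j≠i} χ(g_i,g_j))·[x_1,…,x̂_i,…,x_{n+1}]·x_i) = 0`.
Here the cycle `c_i` with `c_i(1) = i`, `c_i(j) = j−1` for `2 ≤ j ≤ i`, `c_i(j) = j` else, is
`(Fin.cycleRange i)⁻¹`, and the `i`-th entry is omitted via `Fin.succAbove i`. -/
theorem first_jacobi {k G A : Type*} [CommRing k] [IsDomain k] [AddCommGroup G]
    [DecidableEq G] [Ring A] [Algebra k A]
    (χ : G → G → kˣ) (hχ : IsBicharacter χ) {n : ℕ} (ζ : kˣ)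
    (hζn : ζ ^ n = 1) (hζprim : ∀ m : ℕ, 0 < m → m < n → ζ ^ m ≠ 1)
    (𝒜 : G → Submodule k A) (hinternal : DirectSum.IsInternal 𝒜)
    (hgmul : ∀ {a b : G} {u v : A}, u ∈ 𝒜 a → v ∈ 𝒜 b → u * v ∈ 𝒜 (a + b))
    (g : Fin (n + 1) → G) (hg : IsZetaFamily χ ζ g)
    (x : Fin (n + 1) → A) (hx : ∀ i, x i ∈ 𝒜 (g i)) :
    ∑ i : Fin (n + 1), ((rho χ ζ (Fin.cycleRange i)⁻¹ g : kˣ) : k) •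
      (x i * bracket χ ζ (fun j => g (i.succAbove j)) (fun j => x (i.succAbove j))
        - ((∏ j ∈ Finset.univ.erase i, χ (g i) (g j) : kˣ) : k) •
          (bracket χ ζ (fun j => g (i.succAbove j)) (fun j => x (i.succAbove j)) * x i))
      = 0 := by
  have hfirst : ∑ i, ((rho χ ζ (Fin.cycleRange i)⁻¹ g : kˣ) : k) •
      (x i * bracket χ ζ (fun j => g (i.succAbove j)) (fun j => x (i.succAbove j))) =
      bracket χ ζ g x := by
    rw [bracket_eq_sum_insertPerm χ ζ g x 0]
    refine Finset.sum_congr rfl fun i _ => ?_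
    rw [bracket, Finset.mul_sum, Finset.smul_sum]
    refine Finset.sum_congr rfl fun τ _ => ?_
    rw [mul_smul_comm, smul_smul, ← Units.val_mul, rho_cycleRange_inv_mul,
      prod_ofFn_insertPerm_zero]
  have hsecond : ∑ i, ((rho χ ζ (Fin.cycleRange i)⁻¹ g : kˣ) : k) •
      ((∏ j ∈ Finset.univ.erase i, χ (g i) (g j) : kˣ) : k) •
        (bracket χ ζ (fun j => g (i.succAbove j)) (fun j => x (i.succAbove j)) * x i) =
      bracket χ ζ g x := by
    rw [bracket_eq_sum_insertPerm χ ζ g x (Fin.last n)]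
    refine Finset.sum_congr rfl fun i _ => ?_
    rw [bracket, Finset.sum_mul, Finset.smul_sum, Finset.smul_sum]
    refine Finset.sum_congr rfl fun τ _ => ?_
    rw [smul_mul_assoc, smul_smul, smul_smul, ← Units.val_mul, ← Units.val_mul,
      rho_cycleRange_inv_mul_prod hζn hg, prod_ofFn_insertPerm_last]
  simp only [smul_sub, Finset.sum_sub_distrib]
  rw [hfirst, hsecond, sub_self]
end

section
/- Let ζ ∈ k be a primitive n-th root of unity and let i be an integer with 1 < i < n. Then Σ_{t=0}^{i(n−i)} p(i, n−i, t)·ζ^t = 0, where p(i, m, t) denotes the number of partitions of t into at most m parts, each part of size at most i. (This is the vanishing of the coefficients c_{1,i} in the proof of the main theorem, via Sylvester's formula Σ_t p(i,n−i,t) q^t = (1−q^n)(1−q^{n−1})⋯(1−q^{n−i+1}) / ((1−q^i)(1−q^{i−1})⋯(1−q)).) -/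
/-- `numPartitions i m t` is the number `p(i,m,t)` of partitions of `t` into at most `m`
parts, each part of size at most `i` (encoded as weakly decreasing sequences of length `m`
with values in `{0,…,i}` summing to `t`). -/
def numPartitions (i m t : ℕ) : ℕ :=
  ((Finset.univ : Finset (Fin m → Fin (i + 1))).filter
    (fun f => (∀ a b : Fin m, a ≤ b → (f b : ℕ) ≤ (f a : ℕ)) ∧ ∑ a, (f a : ℕ) = t)).card

/-- The Gaussian binomial coefficient `[i + m choose i]` evaluated at `q`, as the sum of `q ^ |f|`
over the weakly decreasing sequences `f` of length `m` with values in `{0, …, i}`. -/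
noncomputable def gaussianSum {k : Type*} [CommRing k] (q : k) (i m : ℕ) : k :=
  open Classical in
  ∑ f : Fin m → Fin (i + 1) with Antitone f, q ^ ∑ a, (f a : ℕ)

theorem sum_numPartitions_mul_pow {k : Type*} [CommRing k] (q : k) (i m : ℕ) :
    ∑ t ∈ Finset.range (i * m + 1), (numPartitions i m t : k) * q ^ t = gaussianSum q i m := by
  classical
  have hmaps : ∀ f ∈ Finset.univ.filter (fun f : Fin m → Fin (i + 1) => Antitone f),
      ∑ a, (f a : ℕ) ∈ Finset.range (i * m + 1) := by
    intro f _
    have h : ∑ a, (f a : ℕ) ≤ ∑ _a : Fin m, i :=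
      Finset.sum_le_sum fun a _ => Nat.lt_succ_iff.mp (f a).isLt
    simp only [Finset.sum_const, Finset.card_univ, Fintype.card_fin, smul_eq_mul] at h
    rw [Finset.mem_range, mul_comm]
    omega
  rw [gaussianSum, ← Finset.sum_fiberwise_of_maps_to hmaps]
  refine Finset.sum_congr rfl fun t _ => ?_
  rw [Finset.sum_congr rfl (g := fun _ => q ^ t)
    (fun f hf => by rw [(Finset.mem_filter.mp hf).2]), Finset.sum_const, nsmul_eq_mul,
    Finset.filter_filter, numPartitions]
  rfl

@[simp]
theorem gaussianSum_zero_left {k : Type*} [CommRing k] (q : k) (m : ℕ) :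
    gaussianSum q 0 m = 1 := by
  classical
  have h : ∀ f : Fin m → Fin (0 + 1), Antitone f := fun f a b _ => by omega
  simp [gaussianSum, h]

@[simp]
theorem gaussianSum_zero_right {k : Type*} [CommRing k] (q : k) (i : ℕ) :
    gaussianSum q i 0 = 1 := by
  classical
  have h : ∀ f : Fin 0 → Fin (i + 1), Antitone f := fun f a => a.elim0
  simp [gaussianSum, h]

/-- The `q`-Pascal recurrence, by splitting on whether the largest part is maximal. -/
theorem gaussianSum_succ_succ {k : Type*} [CommRing k] (q : k) (i m : ℕ) :
    gaussianSum q (i + 1) (m + 1) =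
      q ^ (i + 1) * gaussianSum q (i + 1) m + gaussianSum q i (m + 1) := by
  classical
  simp only [gaussianSum]
  rw [← Finset.sum_filter_add_sum_filter_not _
    (fun f : Fin (m + 1) → Fin (i + 1 + 1) => f 0 = Fin.last (i + 1)), Finset.mul_sum]
  congr 1
  · symm
    refine Finset.sum_bij (fun g _ => Fin.cons (Fin.last (i + 1)) g) ?_ ?_ ?_ ?_
    · intro g hg
      simp only [Finset.mem_filter, Finset.mem_univ, true_and] at hg ⊢
      refine ⟨fun a b hab => ?_, rfl⟩
      cases a using Fin.cases with
      | zero => exact Fin.le_last _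
      | succ a =>
        cases b using Fin.cases with
        | zero => simp at hab
        | succ b => exact hg (Fin.succ_le_succ_iff.mp hab)
    · intro g _ g' _ h
      exact Fin.cons_right_injective (α := fun _ => Fin (i + 1 + 1)) _ h
    · intro f hf
      simp only [Finset.mem_filter, Finset.mem_univ, true_and] at hf
      refine ⟨Fin.tail f, ?_, ?_⟩
      · simp only [Finset.mem_filter, Finset.mem_univ, true_and]
        exact fun a b hab => hf.1 (Fin.succ_le_succ_iff.mpr hab)
      · rw [← hf.2]
        exact Fin.cons_self_tail f
    · intro g _
      simp [Fin.sum_univ_succ, pow_add]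
  · symm
    refine Finset.sum_bij (fun g _ a => (g a).castSucc) ?_ ?_ ?_ ?_
    · intro g hg
      simp only [Finset.mem_filter, Finset.mem_univ, true_and] at hg ⊢
      exact ⟨fun a b hab => Fin.castSucc_le_castSucc_iff.mpr (hg hab), Fin.castSucc_ne_last _⟩
    · intro g _ g' _ h
      exact funext fun a => Fin.castSucc_injective _ (congrFun h a)
    · intro f hf
      simp only [Finset.mem_filter, Finset.mem_univ, true_and] at hf
      have hne : ∀ a, f a ≠ Fin.last (i + 1) := fun a ha =>
        hf.2 (Fin.last_le_iff.mp (ha ▸ hf.1 (Fin.zero_le a)))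
      refine ⟨fun a => (f a).castPred (hne a), ?_, ?_⟩
      · simp only [Finset.mem_filter, Finset.mem_univ, true_and]
        exact fun a b hab => Fin.castPred_le_castPred_iff.mpr (hf.1 hab)
      · simp
    · intro g _
      simp

/-- Sylvester's product formula, with denominators cleared. -/
theorem gaussianSum_mul_prod {k : Type*} [CommRing k] (q : k) (i m : ℕ) :
    gaussianSum q i m * ∏ j ∈ Finset.range i, (1 - q ^ (j + 1)) =
      ∏ j ∈ Finset.range i, (1 - q ^ (m + j + 1)) := by
  induction i generalizing m with
  | zero => simp
  | succ i ihi =>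
    induction m with
    | zero => simp
    | succ m ihm =>
      have h := ihi (m + 1)
      rw [Finset.prod_range_succ' (fun j => 1 - q ^ (m + j + 1))] at ihm
      have hshift : ∏ j ∈ Finset.range i, (1 - q ^ (m + (j + 1) + 1)) =
          ∏ j ∈ Finset.range i, (1 - q ^ (m + 1 + j + 1)) :=
        Finset.prod_congr rfl fun j _ => by rw [show m + (j + 1) = m + 1 + j by omega]
      rw [hshift] at ihm
      rw [gaussianSum_succ_succ, add_mul, mul_assoc, ihm,
        Finset.prod_range_succ (fun j => 1 - q ^ (j + 1)), ← mul_assoc (gaussianSum q i (m + 1)), h,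
        Finset.prod_range_succ]
      ring

/-- If `ζ` is a primitive `n`-th root of unity in an integral domain and `1 < i < n`, then
`Σ_t p(i, n−i, t)·ζ^t = 0` (Sylvester's Gaussian-binomial evaluation). -/
theorem gaussian_vanishing {k : Type*} [CommRing k] [IsDomain k] (ζ : k) (n i : ℕ)
    (hζn : ζ ^ n = 1) (hζprim : ∀ m : ℕ, 0 < m → m < n → ζ ^ m ≠ 1)
    (hi1 : 1 < i) (hi2 : i < n) :
    ∑ t ∈ Finset.range (i * (n - i) + 1), (numPartitions i (n - i) t : k) * ζ ^ t = 0 := by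
  rw [sum_numPartitions_mul_pow]
  have hprod := gaussianSum_mul_prod ζ i (n - i)
  have hnum : ∏ j ∈ Finset.range i, (1 - ζ ^ (n - i + j + 1)) = 0 := by
    refine Finset.prod_eq_zero (Finset.mem_range.mpr (show i - 1 < i by omega)) ?_
    rw [show n - i + (i - 1) + 1 = n by omega, hζn, sub_self]
  have hden : ∏ j ∈ Finset.range i, (1 - ζ ^ (j + 1)) ≠ 0 := by
    refine Finset.prod_ne_zero_iff.mpr fun j hj => sub_ne_zero.mpr (Ne.symm ?_)
    have := Finset.mem_range.mp hj
    exact hζprim (j + 1) (by omega) (by omega)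
  exact (mul_eq_zero.mp (hprod.trans hnum)).resolve_right hden
end

section
/- Let ζ ∈ kˣ, let (g_1,…,g_n) be a ζ-family, and let τ ∈ S_n be the order-reversing permutation τ(i) = n+1−i. Then ρ(τ,(g_1,…,g_n)) = ζ^{n(n−1)/2} · ∏_{i<j} χ(g_j,g_i)^{−1}. In particular, if ζ is a primitive n-th root of unity then ρ(τ,(g_1,…,g_n)) = (−1)^{n−1} · ∏_{i<j} χ(g_j,g_i)^{−1}. -/
open Finset

/-- There are `n(n-1)/2` pairs `i < j` in `Fin n`. -/
theorem card_filter_fst_lt_snd (n : ℕ) :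
    #{p : Fin n × Fin n | p.1 < p.2} = n * (n - 1) / 2 := by
  rw [card_filter, Fintype.sum_prod_type_right]
  simp_rw [← card_filter, Finset.filter_gt_eq_Iio, Fin.card_Iio]
  rw [Fin.sum_univ_eq_sum_range (fun i => i), sum_range_id]

/-- Every pair `i < j` is an inversion of the order-reversing permutation. -/
theorem inversions_revPerm (n : ℕ) :
    inversions (Fin.revPerm : Equiv.Perm (Fin n)) =
      Finset.univ.filter (fun p : Fin n × Fin n => p.1 < p.2) := by
  ext p
  simp [inversions]

/-- `∏_{i<j} f(rev j, rev i) = ∏_{i<j} f(i, j)`. -/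
theorem prod_filter_lt_rev {M : Type*} [CommMonoid M] {n : ℕ} (f : Fin n → Fin n → M) :
    ∏ p : Fin n × Fin n with p.1 < p.2, f p.2.rev p.1.rev =
      ∏ p : Fin n × Fin n with p.1 < p.2, f p.1 p.2 :=
  prod_bij' (fun p _ => (p.2.rev, p.1.rev)) (fun p _ => (p.2.rev, p.1.rev))
    (by simp) (by simp) (by simp) (by simp) (by simp)

/-- A primitive `n`-th root of unity `ζ` satisfies `ζ^{n(n-1)/2} = (-1)^{n-1}`. -/
theorem IsPrimitiveRoot.units_pow_mul_pred_div_two {k : Type*} [CommRing k] [IsDomain k]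
    {ζ : kˣ} {n : ℕ} (hζ : IsPrimitiveRoot ζ n) :
    ζ ^ (n * (n - 1) / 2) = (-1) ^ (n - 1) := by
  obtain ⟨m, rfl | rfl⟩ := n.even_or_odd'
  · rcases m.eq_zero_or_pos with rfl | hm
    · simp
    have h : ζ ^ m = -1 := by
      have h2 : IsPrimitiveRoot ((ζ : k) ^ m) 2 :=
        (IsPrimitiveRoot.coe_units_iff.mpr hζ).pow (by omega) (mul_comm 2 m)
      exact Units.ext (by simpa using h2.eq_neg_one_of_two_right)
    rw [mul_assoc, Nat.mul_div_cancel_left _ two_pos, pow_mul, h]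
  · rw [Nat.add_sub_cancel, mul_left_comm, Nat.mul_div_cancel_left _ two_pos, pow_mul,
      hζ.pow_eq_one, one_pow, pow_mul, neg_one_sq, one_pow]

/-- For the order-reversing permutation `τ(i) = n+1−i` and a `ζ`-family `(g_1,…,g_n)`,
`ρ(τ,(g_•)) = ζ^{n(n−1)/2} · ∏_{i<j} χ(g_j,g_i)⁻¹`; if moreover `ζ` is a primitive `n`-th
root of unity then `ρ(τ,(g_•)) = (−1)^{n−1} · ∏_{i<j} χ(g_j,g_i)⁻¹`. -/
theorem rho_reversal {k G : Type*} [CommRing k] [IsDomain k] [AddCommGroup G]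
    (χ : G → G → kˣ) (hχ : IsBicharacter χ) (ζ : kˣ) {n : ℕ}
    (g : Fin n → G) (hg : IsZetaFamily χ ζ g) :
    rho χ ζ Fin.revPerm g
        = ζ ^ (n * (n - 1) / 2) *
            ∏ p ∈ Finset.univ.filter (fun p : Fin n × Fin n => p.1 < p.2),
              (χ (g p.2) (g p.1))⁻¹ ∧
      ((ζ ^ n = 1 ∧ ∀ m : ℕ, 0 < m → m < n → ζ ^ m ≠ 1) →
        rho χ ζ Fin.revPerm g
          = (-1) ^ (n - 1) *
              ∏ p ∈ Finset.univ.filter (fun p : Fin n × Fin n => p.1 < p.2),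
                (χ (g p.2) (g p.1))⁻¹) := by
  have h : rho χ ζ Fin.revPerm g
      = ζ ^ (n * (n - 1) / 2) *
          ∏ p ∈ Finset.univ.filter (fun p : Fin n × Fin n => p.1 < p.2),
            (χ (g p.2) (g p.1))⁻¹ := by
    simp only [rho, inversions_revPerm, Fin.revPerm_apply]
    rw [prod_filter_lt_rev fun i j => ζ⁻¹ * χ (g i) (g j), ← card_filter_fst_lt_snd,
      ← prod_const, ← prod_mul_distrib]
    refine prod_congr rfl fun p hp => ?_
    have hp' := hg p.1 p.2 (mem_filter.mp hp).2.ne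
    rw [eq_mul_inv_iff_mul_eq, mul_assoc, hp', sq, inv_mul_cancel_left]
  refine ⟨h, fun ⟨hn, hlt⟩ => ?_⟩
  rw [h]
  rcases n.eq_zero_or_pos with rfl | hpos
  · simp
  · rw [(IsPrimitiveRoot.mk_of_lt ζ hpos hn hlt).units_pow_mul_pred_div_two]
end

section
/- Let ζ ∈ k be a primitive n-th root of unity, let (g_1,…,g_n) be a ζ-family, let σ ∈ S_n, and let τ ∈ S_n be the order-reversing permutation τ(i) = n+1−i. Then ρ(σ,(g_1,…,g_n)) · ∏_{i<j} χ(g_{σ(j)}, g_{σ(i)})^{−1} = (−1)^{n−1} · ρ(στ,(g_1,…,g_n)). -/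
open Finset

/-- A primitive `n`-th root of unity in a domain satisfies `ζ ^ (n choose 2) = (-1) ^ (n - 1)`. -/
theorem pow_mul_pred_div_two_eq_neg_one_pow {k : Type*} [CommRing k] [IsDomain k] {n : ℕ} (ζ : kˣ)
    (hζn : ζ ^ n = 1) (hζprim : ∀ m : ℕ, 0 < m → m < n → ζ ^ m ≠ 1) :
    ζ ^ (n * (n - 1) / 2) = (-1) ^ (n - 1) := by
  obtain ⟨m, rfl | rfl⟩ := n.even_or_odd'
  · rcases m.eq_zero_or_pos with rfl | hm
    · simp
    · have hsq : (ζ ^ m) ^ 2 = 1 := by rw [← pow_mul, mul_comm m 2, hζn]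
      have hneg : ζ ^ m = -1 := by
        have h : ((ζ ^ m : kˣ) : k) ^ 2 = 1 := by rw [← Units.val_pow_eq_pow_val, hsq, Units.val_one]
        rcases eq_or_eq_neg_of_sq_eq_sq _ 1 (h.trans (one_pow 2).symm) with h | h
        · exact absurd (Units.ext h) (hζprim m hm (by lia))
        · exact Units.ext h
      rw [mul_assoc, Nat.mul_div_cancel_left _ two_pos, pow_mul, hneg]
  · rw [Nat.add_sub_cancel, mul_left_comm, Nat.mul_div_cancel_left _ two_pos, pow_mul, hζn, one_pow,
      pow_mul, neg_one_sq, one_pow]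

/-- Precomposing with the order reversal turns inversions into non-inversions. -/
theorem rho_mul_revPerm {k G : Type*} [CommRing k] (χ : G → G → kˣ) (ζ : kˣ) {n : ℕ}
    (σ : Equiv.Perm (Fin n)) (g : Fin n → G) :
    rho χ ζ (σ * Fin.revPerm) g =
      ∏ p : Fin n × Fin n with p.1 < p.2 ∧ ¬ σ p.2 < σ p.1,
        ζ⁻¹ * χ (g (σ p.1)) (g (σ p.2)) := by
  unfold rho inversions
  refine Finset.prod_bij' (fun p _ => (p.2.rev, p.1.rev)) (fun p _ => (p.2.rev, p.1.rev))
    ?_ ?_ ?_ ?_ ?_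
  · rintro ⟨i, j⟩ h
    simp only [Finset.mem_filter, Finset.mem_univ, true_and, Equiv.Perm.mul_apply,
      Fin.revPerm_apply] at h ⊢
    exact ⟨Fin.rev_lt_rev.mpr h.1, h.2.not_gt⟩
  · rintro ⟨i, j⟩ h
    simp only [Finset.mem_filter, Finset.mem_univ, true_and, Equiv.Perm.mul_apply,
      Fin.revPerm_apply, Fin.rev_rev] at h ⊢
    exact ⟨Fin.rev_lt_rev.mpr h.1, lt_of_le_of_ne (not_lt.mp h.2) (σ.injective.ne h.1.ne)⟩
  all_goals simp

/-- For `ζ` a primitive `n`-th root of unity, a `ζ`-family `(g_1,…,g_n)`, `σ ∈ S_n` and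
the order-reversing permutation `τ(i) = n+1−i`,
`ρ(σ,(g_•)) · ∏_{i<j} χ(g_{σ(j)}, g_{σ(i)})⁻¹ = (−1)^{n−1} · ρ(στ,(g_•))`. -/
theorem rho_mul_reversal {k G : Type*} [CommRing k] [IsDomain k] [AddCommGroup G]
    (χ : G → G → kˣ) (hχ : IsBicharacter χ) {n : ℕ} (ζ : kˣ)
    (hζn : ζ ^ n = 1) (hζprim : ∀ m : ℕ, 0 < m → m < n → ζ ^ m ≠ 1)
    (g : Fin n → G) (hg : IsZetaFamily χ ζ g) (σ : Equiv.Perm (Fin n)) :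
    rho χ ζ σ g *
        ∏ p ∈ Finset.univ.filter (fun p : Fin n × Fin n => p.1 < p.2),
          (χ (g (σ p.2)) (g (σ p.1)))⁻¹
      = (-1) ^ (n - 1) * rho χ ζ (σ * Fin.revPerm) g := by
  have hrev : rho χ ζ (σ * Fin.revPerm) g =
      ∏ p : Fin n × Fin n with p.1 < p.2 ∧ ¬ σ p.2 < σ p.1,
        ζ * (χ (g (σ p.2)) (g (σ p.1)))⁻¹ := by
    rw [rho_mul_revPerm]
    refine Finset.prod_congr rfl fun p hp => ?_
    have h := hg _ _ (σ.injective.ne (Finset.mem_filter.mp hp).2.1.ne)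
    rw [eq_mul_inv_iff_mul_eq, mul_assoc, h, sq, inv_mul_cancel_left]
  have hpow : (-1 : kˣ) ^ (n - 1) = ∏ p : Fin n × Fin n with p.1 < p.2, ζ⁻¹ := by
    rw [Finset.prod_const, card_filter_fst_lt_snd, inv_pow,
      pow_mul_pred_div_two_eq_neg_one_pow ζ hζn hζprim, ← inv_pow, inv_neg, inv_one]
  rw [hrev, hpow, rho, inversions, ← Finset.filter_filter, ← Finset.filter_filter,
    Finset.prod_filter (p := fun p : Fin n × Fin n => σ p.2 < σ p.1), Finset.prod_filter
    (p := fun p : Fin n × Fin n => ¬ σ p.2 < σ p.1),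
    ← Finset.prod_mul_distrib, ← Finset.prod_mul_distrib]
  refine Finset.prod_congr rfl fun p _ => ?_
  by_cases h : σ p.2 < σ p.1 <;> simp [h]
end

section
/- (The bracket in the braided opposite algebra) Let ζ ∈ k be a primitive n-th root of unity, let (g_1,…,g_n) be a ζ-family, and let x_i ∈ A_{g_i}. Then Σ_{σ∈S_n} ρ(σ,(g_1,…,g_n)) · (∏_{i<j} χ(g_{σ(i)}, g_{σ(j)})) · x_{σ(n)}·x_{σ(n−1)}⋯x_{σ(1)} = (−1)^{n−1} · [x_1,…,x_n]. (Equivalently, the bracket computed in the braided opposite algebra, with product x∘y = χ(deg x, deg y)·y·x on homogeneous elements, equals (−1)^{n−1} times the bracket in A; this is the key step showing the antipode of the universal enveloping algebra is a Lie homomorphism.) -/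
open Finset

/-- The number of pairs `i < j` in `Fin n` is `n choose 2`. -/
theorem card_filter_fst_lt_snd_s13 (n : ℕ) :
    (Finset.univ.filter fun p : Fin n × Fin n => p.1 < p.2).card = n.choose 2 := by
  have h : (Finset.univ.filter fun p : Fin n × Fin n => p.1 < p.2).card
      = ∑ j : Fin n, (j : ℕ) := by
    rw [Finset.card_filter, Fintype.sum_prod_type_right]
    refine Finset.sum_congr rfl fun j _ => ?_
    rw [← Finset.card_filter, Finset.filter_gt_eq_Iio, Fin.card_Iio]
  rw [h, Fin.sum_univ_eq_sum_range (fun i => i) n, Finset.sum_range_id, Nat.choose_two_right]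

/-- A primitive `n`-th root of unity in a domain satisfies `ζ ^ (n choose 2) = (-1) ^ (n - 1)`. -/
theorem IsPrimitiveRoot.pow_choose_two {k : Type*} [CommRing k] [IsDomain k] {n : ℕ} {ζ : k}
    (h : IsPrimitiveRoot ζ n) : ζ ^ n.choose 2 = (-1) ^ (n - 1) := by
  rcases Nat.even_or_odd' n with ⟨m, rfl | rfl⟩
  · rcases Nat.eq_zero_or_pos m with rfl | hm
    · simp
    · have hneg : ζ ^ m = -1 :=
        (h.pow (a := m) (b := 2) (by lia) (by ring)).eq_neg_one_of_two_right
      rw [Nat.choose_two_right, mul_assoc, Nat.mul_div_cancel_left _ two_pos, pow_mul, hneg]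
  · rw [Nat.choose_two_right, Nat.add_sub_cancel, mul_left_comm,
      Nat.mul_div_cancel_left _ two_pos, pow_mul, h.pow_eq_one, one_pow, pow_mul]
    simp

/-- Precomposing with the order reversal turns the inversions of `σ` into its non-inversions. -/
theorem rho_revPerm_trans {k G : Type*} [CommRing k] (χ : G → G → kˣ) (ζ : kˣ) {n : ℕ}
    (σ : Equiv.Perm (Fin n)) (g : Fin n → G) :
    rho χ ζ (Fin.revPerm.trans σ) g =
      ∏ p ∈ Finset.univ.filter (fun p : Fin n × Fin n => p.1 < p.2),
        if σ p.2 < σ p.1 then 1 else ζ⁻¹ * χ (g (σ p.1)) (g (σ p.2)) := by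
  rw [Finset.prod_ite, Finset.prod_const_one, one_mul, rho]
  refine Finset.prod_nbij' (fun p => (p.2.rev, p.1.rev)) (fun p => (p.2.rev, p.1.rev))
    ?_ ?_ (by simp) (by simp) (by simp)
  · rintro ⟨i, j⟩ h
    simp only [inversions, Finset.mem_filter, Finset.mem_univ, true_and, Equiv.trans_apply,
      Fin.revPerm_apply, Fin.rev_lt_rev] at h ⊢
    exact ⟨h.1, h.2.not_gt⟩
  · rintro ⟨i, j⟩ h
    simp only [inversions, Finset.mem_filter, Finset.mem_univ, true_and, Equiv.trans_apply,
      Fin.revPerm_apply, Fin.rev_lt_rev, Fin.rev_rev] at h ⊢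
    exact ⟨h.1, lt_of_le_of_ne (not_lt.mp h.2) (σ.injective.ne h.1.ne)⟩

/-- The coefficient of the reversed monomial of `σ` in the braided opposite bracket, in terms of
the coefficient of that monomial in the bracket. -/
theorem rho_mul_prod_eq_pow_mul_rho {k G : Type*} [CommRing k] {χ : G → G → kˣ} {ζ : kˣ} {n : ℕ}
    {g : Fin n → G} (hg : IsZetaFamily χ ζ g) (σ : Equiv.Perm (Fin n)) :
    rho χ ζ σ g * ∏ p ∈ Finset.univ.filter (fun p : Fin n × Fin n => p.1 < p.2),
        χ (g (σ p.1)) (g (σ p.2)) =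
      ζ ^ n.choose 2 * rho χ ζ (Fin.revPerm.trans σ) g := by
  rw [rho_revPerm_trans, rho, inversions, ← Finset.filter_filter, Finset.prod_filter,
    ← card_filter_fst_lt_snd_s13, ← Finset.prod_const, ← Finset.prod_mul_distrib,
    ← Finset.prod_mul_distrib]
  refine Finset.prod_congr rfl fun p hp => ?_
  have hne : σ p.2 ≠ σ p.1 := σ.injective.ne (Finset.mem_filter.mp hp).2.ne'
  split_ifs
  · rw [mul_assoc, hg _ _ hne, sq, inv_mul_cancel_left, mul_one]
  · rw [one_mul, mul_inv_cancel_left]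

/-- (The bracket in the braided opposite algebra) For `ζ` a primitive `n`-th root of unity,
a `ζ`-family `(g_1,…,g_n)` and `x_i ∈ A_{g_i}`,
`Σ_σ ρ(σ,(g_•)) (∏_{i<j} χ(g_{σ(i)},g_{σ(j)})) x_{σ(n)}⋯x_{σ(1)} = (−1)^{n−1}·[x_1,…,x_n]`. -/
theorem bracket_braided_opposite {k G A : Type*} [CommRing k] [IsDomain k] [AddCommGroup G]
    [DecidableEq G] [Ring A] [Algebra k A]
    (χ : G → G → kˣ) (hχ : IsBicharacter χ) {n : ℕ} (ζ : kˣ)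
    (hζn : ζ ^ n = 1) (hζprim : ∀ m : ℕ, 0 < m → m < n → ζ ^ m ≠ 1)
    (𝒜 : G → Submodule k A) (hinternal : DirectSum.IsInternal 𝒜)
    (hgmul : ∀ {a b : G} {u v : A}, u ∈ 𝒜 a → v ∈ 𝒜 b → u * v ∈ 𝒜 (a + b))
    (g : Fin n → G) (hg : IsZetaFamily χ ζ g)
    (x : Fin n → A) (hx : ∀ i, x i ∈ 𝒜 (g i)) :
    ∑ σ : Equiv.Perm (Fin n),
        (((rho χ ζ σ g *
            ∏ p ∈ Finset.univ.filter (fun p : Fin n × Fin n => p.1 < p.2),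
              χ (g (σ p.1)) (g (σ p.2)) : kˣ)) : k) •
          (List.ofFn fun i => x (σ i)).reverse.prod
      = ((-1 : k) ^ (n - 1)) • bracket χ ζ g x := by
  have hpow : (ζ : k) ^ n.choose 2 = (-1) ^ (n - 1) := by
    rcases Nat.eq_zero_or_pos n with rfl | hn
    · simp
    · exact (IsPrimitiveRoot.coe_units_iff.mpr
        (IsPrimitiveRoot.mk_of_lt ζ hn hζn hζprim)).pow_choose_two
  rw [bracket, Finset.smul_sum]
  refine Fintype.sum_equiv (Equiv.mulRight Fin.revPerm) _ _ fun σ => ?_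
  have hrev : (List.ofFn fun i => x (σ i)).reverse
      = List.ofFn fun i => x ((Equiv.mulRight Fin.revPerm σ) i) := by
    refine List.ext_getElem (by simp) fun i h₁ h₂ => ?_
    simp only [List.getElem_reverse, List.getElem_ofFn, List.length_ofFn]
    refine congrArg (fun j => x (σ j)) (Fin.ext ?_)
    change n - 1 - i = n - (i + 1)
    lia
  rw [rho_mul_prod_eq_pow_mul_rho hg, hrev, Units.val_mul, Units.val_pow_eq_pow_val, hpow,
    mul_smul]
  rfl
end

section
/- Let ζ ∈ kˣ with ζⁿ = 1 and let (g_1,…,g_{n+1}) be a ζ-family. Fix 1 ≤ i ≤ n+1. Let c_i ∈ S_{n+1} be the cycle with c_i(1) = i, c_i(j) = j−1 for 2 ≤ j ≤ i, c_i(j) = j for j > i, and let d_i ∈ S_{n+1} be the cycle with d_i(n+1) = i, d_i(j) = j+1 for i ≤ j ≤ n, d_i(j) = j for j < i. Then ρ(c_i,(g_1,…,g_{n+1})) · ∏_{j≠i} χ(g_i,g_j) = ρ(d_i,(g_1,…,g_{n+1})). Moreover ρ(c_i,(g_1,…,g_{n+1})) = ∏_{j<i} ζ⁻¹χ(g_j,g_i)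 and ρ(d_i,(g_1,…,g_{n+1})) = ∏_{j>i} ζ⁻¹χ(g_i,g_j). -/
open Finset

theorem val_cycleRange {n : ℕ} (i j : Fin (n + 1)) :
    (Fin.cycleRange i j : ℕ) =
      if (j : ℕ) < i then (j : ℕ) + 1 else if (j : ℕ) = i then 0 else j := by
  split_ifs with h₁ h₂
  · exact Fin.coe_cycleRange_of_lt h₁
  · rw [Fin.cycleRange_of_eq (Fin.ext h₂)]; rfl
  · rw [Fin.cycleRange_of_gt (show i < j by rw [Fin.lt_def]; omega)]

theorem cycleRange_reverses_iff {n : ℕ} (i a b : Fin (n + 1)) :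
    (b < a ∧ Fin.cycleRange i a < Fin.cycleRange i b) ↔ a = i ∧ b < i := by
  simp only [Fin.lt_def, Fin.ext_iff, val_cycleRange]
  split_ifs <;> omega

theorem rho_eq_of_reverses_iff_left {k G : Type*} [CommRing k] [AddCommGroup G]
    (χ : G → G → kˣ) (ζ : kˣ) {n : ℕ} (g : Fin n → G) (σ : Equiv.Perm (Fin n)) (i : Fin n)
    (h : ∀ a b, (b < a ∧ σ⁻¹ a < σ⁻¹ b) ↔ a = i ∧ b < i) :
    rho χ ζ σ g = ∏ j ∈ Finset.univ.filter (fun j => j < i), ζ⁻¹ * χ (g j) (g i) := by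
  have key : ∀ p ∈ inversions σ, σ p.1 = i ∧ σ p.2 < i := fun p hp => by
    rw [← h]
    simpa [inversions, and_comm] using hp
  refine Finset.prod_nbij' (fun p => σ p.2) (fun j => (σ⁻¹ i, σ⁻¹ j)) ?_ ?_ ?_ ?_ ?_
  · exact fun p hp => by simpa using (key p hp).2
  · intro j hj
    have := (h i j).2 ⟨rfl, by simpa using hj⟩
    simpa [inversions, and_comm] using this
  · exact fun p hp => by simp [← (key p hp).1]
  · simp
  · exact fun p hp => by rw [(key p hp).1]

theorem rho_eq_of_reverses_iff_right {k G : Type*} [CommRing k] [AddCommGroup G]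
    (χ : G → G → kˣ) (ζ : kˣ) {n : ℕ} (g : Fin n → G) (σ : Equiv.Perm (Fin n)) (i : Fin n)
    (h : ∀ a b, (b < a ∧ σ⁻¹ a < σ⁻¹ b) ↔ b = i ∧ i < a) :
    rho χ ζ σ g = ∏ j ∈ Finset.univ.filter (fun j => i < j), ζ⁻¹ * χ (g i) (g j) := by
  have key : ∀ p ∈ inversions σ, σ p.2 = i ∧ i < σ p.1 := fun p hp => by
    rw [← h]
    simpa [inversions, and_comm] using hp
  refine Finset.prod_nbij' (fun p => σ p.1) (fun j => (σ⁻¹ j, σ⁻¹ i)) ?_ ?_ ?_ ?_ ?_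
  · exact fun p hp => by simpa using (key p hp).2
  · intro j hj
    have := (h j i).2 ⟨rfl, by simpa using hj⟩
    simpa [inversions, and_comm] using this
  · exact fun p hp => by simp [← (key p hp).1]
  · simp
  · exact fun p hp => by rw [(key p hp).1]

theorem rho_cycleRange_inv {k G : Type*} [CommRing k] [AddCommGroup G]
    (χ : G → G → kˣ) (ζ : kˣ) {n : ℕ} (g : Fin (n + 1) → G) (i : Fin (n + 1)) :
    rho χ ζ (Fin.cycleRange i)⁻¹ g
      = ∏ j ∈ Finset.univ.filter (fun j => j < i), ζ⁻¹ * χ (g j) (g i) :=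
  rho_eq_of_reverses_iff_left χ ζ g _ i fun a b => by
    rw [inv_inv]; exact cycleRange_reverses_iff i a b

theorem rho_rev_cycleRange_inv_rev {k G : Type*} [CommRing k] [AddCommGroup G]
    (χ : G → G → kˣ) (ζ : kˣ) {n : ℕ} (g : Fin (n + 1) → G) (i : Fin (n + 1)) :
    rho χ ζ (Fin.revPerm * (Fin.cycleRange i.rev)⁻¹ * Fin.revPerm) g
      = ∏ j ∈ Finset.univ.filter (fun j => i < j), ζ⁻¹ * χ (g i) (g j) := by
  refine rho_eq_of_reverses_iff_right χ ζ g _ i fun a b => ?_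
  have hinv : (Fin.revPerm * (Fin.cycleRange i.rev)⁻¹ * Fin.revPerm)⁻¹
      = Fin.revPerm * Fin.cycleRange i.rev * Fin.revPerm := by
    have hrev : (Fin.revPerm : Equiv.Perm (Fin (n + 1)))⁻¹ = Fin.revPerm := Fin.revPerm_symm
    simp only [mul_inv_rev, inv_inv, hrev, mul_assoc]
  have := cycleRange_reverses_iff i.rev b.rev a.rev
  simpa only [hinv, Equiv.Perm.mul_apply, Fin.revPerm_apply, Fin.rev_lt_rev, Fin.rev_inj]
    using this

/-- Let `ζⁿ = 1` and `(g_1,…,g_{n+1})` a `ζ`-family. With `c_i` the cycle `(i … 1)`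
(`c_i = (Fin.cycleRange i)⁻¹`) and `d_i` the cycle `(i … n+1)`
(`d_i = rev ∘ (Fin.cycleRange i.rev)⁻¹ ∘ rev`):
`ρ(c_i,(g_•))·∏_{j≠i} χ(g_i,g_j) = ρ(d_i,(g_•))`, and moreover
`ρ(c_i,(g_•)) = ∏_{j<i} ζ⁻¹χ(g_j,g_i)` and `ρ(d_i,(g_•)) = ∏_{j>i} ζ⁻¹χ(g_i,g_j)`. -/
theorem rho_cycles {k G : Type*} [CommRing k] [IsDomain k] [AddCommGroup G]
    (χ : G → G → kˣ) (hχ : IsBicharacter χ) {n : ℕ} (ζ : kˣ) (hζn : ζ ^ n = 1)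
    (g : Fin (n + 1) → G) (hg : IsZetaFamily χ ζ g) (i : Fin (n + 1)) :
    rho χ ζ (Fin.cycleRange i)⁻¹ g * ∏ j ∈ Finset.univ.erase i, χ (g i) (g j)
        = rho χ ζ (Fin.revPerm * (Fin.cycleRange i.rev)⁻¹ * Fin.revPerm) g ∧
      rho χ ζ (Fin.cycleRange i)⁻¹ g
        = ∏ j ∈ Finset.univ.filter (fun j => j < i), ζ⁻¹ * χ (g j) (g i) ∧
      rho χ ζ (Fin.revPerm * (Fin.cycleRange i.rev)⁻¹ * Fin.revPerm) g
        = ∏ j ∈ Finset.univ.filter (fun j => i < j), ζ⁻¹ * χ (g i) (g j) := by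
  rw [rho_cycleRange_inv, rho_rev_cycleRange_inv_rev]
  refine ⟨?_, rfl, rfl⟩
  have hsplit : Finset.univ.erase i =
      Finset.univ.filter (fun j => j < i) ∪ Finset.univ.filter (fun j => i < j) := by
    ext j
    simp [lt_or_lt_iff_ne]
  have hdisj : Disjoint (Finset.univ.filter (fun j => j < i))
      (Finset.univ.filter (fun j => i < j)) :=
    Finset.disjoint_filter.2 fun j _ h => h.asymm
  have hbelow : (∏ j ∈ Finset.univ.filter (fun j => j < i), ζ⁻¹ * χ (g j) (g i)) *
      ∏ j ∈ Finset.univ.filter (fun j => j < i), χ (g i) (g j) = ζ ^ (i : ℕ) := by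
    rw [← Finset.prod_mul_distrib, Finset.prod_congr rfl (g := fun _ => ζ)]
    · rw [Finset.prod_const, Finset.filter_gt_eq_Iio, Fin.card_Iio]
    · intro j hj
      rw [mul_assoc, hg j i (Finset.mem_filter.1 hj).2.ne, pow_two, inv_mul_cancel_left]
  have hpow : ζ ^ (i : ℕ) = ζ⁻¹ ^ (n - i : ℕ) := by
    rw [inv_pow, eq_inv_iff_mul_eq_one, ← pow_add, Nat.add_sub_cancel' i.is_le, hζn]
  rw [hsplit, Finset.prod_union hdisj, ← mul_assoc, hbelow, hpow, Finset.prod_mul_distrib,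
    Finset.prod_const,
    Finset.filter_lt_eq_Ioi, Fin.card_Ioi, Nat.add_sub_cancel]
end
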